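/- arXiv:1806.05562 — 3 statements merged into one kernel-verified Lean document; each statement's English description precedes it below -/
import Mathlib

section
/- Let G = (V, E) be a cactus graph containing at least two cycles (equivalently, G is connected with |E| ≥ |V| + 1). Then G satisfies the positive semidefinite graph complement conjecture: msr(G) + msr(Ḡ) ≤ |G| + 2. -/
/-- The minimum semidefinite rank of a simple graph `G` on vertex set `Fin n`:
the minimum rank of a real symmetric positive semidefinite matrix whose
off-diagonal zero/nonzero pattern matches the (non-)adjacency of `G`. -/
noncomputable def msr {n : ℕ} (G : SimpleGraph (Fin n)) : ℕ :=
  sInf { r : ℕ | ∃ A : Matrix (Fin n) (Fin n) ℝ, A.PosSemidef ∧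
    (∀ i j : Fin n, i ≠ j → (A i j ≠ 0 ↔ G.Adj i j)) ∧ A.rank = r }

/-- A cactus graph: a simple connected graph in which every edge belongs to at
most one cycle, i.e. any two cycles sharing a common edge have the same edge set. -/
def IsCactus {n : ℕ} (G : SimpleGraph (Fin n)) : Prop :=
  G.Connected ∧
    ∀ (u w : Fin n) (p : G.Walk u u) (q : G.Walk w w), p.IsCycle → q.IsCycle →
      ∀ e ∈ p.edges, e ∈ q.edges → ∀ e', (e' ∈ p.edges ↔ e' ∈ q.edges)


theorem degen {n : ℕ} (G : SimpleGraph (Fin n)) (hG : IsCactus G) (S : Finset (Fin n))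
    (hS : S.Nonempty) : ∃ x ∈ S, ∀ N : Finset (Fin n), (∀ y ∈ N, y ∈ S ∧ G.Adj x y) →
      N.card ≤ 2 := by
  classical
  let P : ℕ → Prop := fun k => ∃ (v w : Fin n) (p : G.Walk v w), p.IsPath ∧
    (∀ x ∈ p.support, x ∈ S) ∧ p.length = k
  obtain ⟨s, hs⟩ := hS
  have h0 : P 0 := ⟨s, s, .nil, by simp, by simpa using hs, rfl⟩
  have hb : ∀ k, P k → k ≤ n := by
    rintro k ⟨v, w, p, hp, -, rfl⟩
    have := hp.length_lt
    simp at this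
    omega
  have hmax := Nat.findGreatest_spec (P := P) (Nat.zero_le n) h0
  set m := Nat.findGreatest P n with hm
  have hmx : ∀ k, P k → k ≤ m := fun k hk => Nat.le_findGreatest (hb k hk) hk
  obtain ⟨v, w, p, hp, hpS, hl⟩ := hmax
  refine ⟨v, hpS _ p.start_mem_support, fun N hN => ?_⟩
  have hsup : ∀ y ∈ N, y ∈ p.support := by
    intro y hy
    by_contra hc
    have := hmx (m + 1) ⟨y, w, .cons (hN y hy).2.symm p, by simp [hp, hc], by
      intro x hx
      simp only [SimpleGraph.Walk.support_cons, List.mem_cons] at hx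
      rcases hx with rfl | hx
      · exact (hN x hy).1
      · exact hpS x hx, by simp [hl]⟩
    omega
  by_contra! hcard
  cases p with
  | nil =>
    obtain ⟨y, hy⟩ : N.Nonempty := Finset.card_pos.mp (by omega)
    have := hsup y hy
    simp at this
    subst this
    exact (hN y hy).2.ne rfl
  | @cons _ z _ h q =>
    rw [SimpleGraph.Walk.cons_isPath_iff] at hp
    have h2 : 1 < (N.erase z).card := by
      have := Finset.pred_card_le_card_erase (s := N) (a := z)
      omega
    obtain ⟨x, hx, y, hy, hxy⟩ := Finset.one_lt_card.mp h2
    simp only [Finset.mem_erase] at hx hy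
    have hq : ∀ y ∈ N, y ∈ q.support := by
      intro y hy
      have := hsup y hy
      simp only [SimpleGraph.Walk.support_cons, List.mem_cons] at this
      rcases this with rfl | h
      · exact absurd (hN y hy).2 (G.irrefl)
      · exact h
    have hnv : ∀ t, s(t, v) ∉ q.edges := fun t ht =>
      hp.2 (q.snd_mem_support_of_mem_edges ht)
    have key : ∀ (x : Fin n) (hx : x ∈ N) (hz : x ≠ z),
        (SimpleGraph.Walk.cons (hN x hx).2.symm
          (SimpleGraph.Walk.cons h (q.takeUntil x (hq x hx)))).IsCycle := by
      intro x hx hz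
      rw [SimpleGraph.Walk.cons_isCycle_iff, SimpleGraph.Walk.cons_isPath_iff]
      refine ⟨⟨hp.1.takeUntil _, fun hc => hp.2 (q.support_takeUntil_subset_support _ hc)⟩, ?_⟩
      simp only [SimpleGraph.Walk.edges_cons, List.mem_cons, not_or]
      refine ⟨?_, fun hc => hnv x (q.edges_takeUntil_subset_edges _ hc)⟩
      have := h.ne
      simp only [Sym2.eq_iff]
      tauto
    have := (hG.2 _ _ _ _ (key x hx.2 hx.1) (key y hy.2 hy.1) s(v, z) (by simp) (by simp)
      s(x, v)).1 (by simp)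
    simp only [SimpleGraph.Walk.edges_cons, List.mem_cons] at this
    rcases this with h3 | h3 | h3
    · simp only [Sym2.eq_iff] at h3
      have := (hN x hx.2).2.ne
      tauto
    · simp only [Sym2.eq_iff] at h3
      have := (hN x hx.2).2.ne
      tauto
    · exact hnv x (q.edges_takeUntil_subset_edges _ h3)

open Submodule in
theorem step {n : ℕ} (G : SimpleGraph (Fin n)) (S : Finset (Fin n)) (a : Fin n)
    (N : Finset (Fin n)) (hN : N ⊆ S) (hNc : N.card ≤ 2) (v : Fin n → EuclideanSpace ℝ (Fin 5))
    (hv : ∀ T ⊆ S, T.card ≤ 3 → LinearIndepOn ℝ v (T : Set (Fin n))) :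
    ∃ x : EuclideanSpace ℝ (Fin 5), (∀ u ∈ N, inner ℝ (v u) x = 0) ∧
      (∀ u ∈ S, u ∉ N → inner ℝ (v u) x ≠ 0) ∧
      ∀ T ⊆ S, T.card ≤ 2 → x ∉ span ℝ (v '' (T : Set (Fin n))) := by
  classical
  set U := span ℝ (v '' (N : Set (Fin n))) with hU
  set W := Uᗮ with hW
  have hfin : ∀ T : Finset (Fin n), Module.finrank ℝ (span ℝ (v '' (T : Set (Fin n)))) ≤ T.card := by
    intro T
    rw [← Finset.coe_image]
    exact (finrank_span_finset_le_card _).trans Finset.card_image_le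
  have hWd : 3 ≤ Module.finrank ℝ W := by
    have h1 := Submodule.finrank_add_finrank_orthogonal U
    have h2 := hfin N
    rw [finrank_euclideanSpace_fin] at h1
    rw [← hU] at h2
    rw [← hW] at h1
    omega
  let F : Finset (Submodule ℝ W) :=
    ((S \ N).image fun u => (span ℝ {v u})ᗮ.comap W.subtype) ∪
    ((S.powerset.filter fun T => T.card ≤ 2).image fun T : Finset (Fin n) =>
      (span ℝ (v '' (T : Set (Fin n)))).comap W.subtype)
  have hF : ⊤ ∉ F := by
    intro h
    simp only [F, Finset.mem_union, Finset.mem_image, Finset.mem_sdiff, Finset.mem_filter,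
      Finset.mem_powerset, Submodule.comap_subtype_eq_top] at h
    rcases h with ⟨u, ⟨hu, huN⟩, h⟩ | ⟨T, ⟨hT, hTc⟩, h⟩
    · have h1 : span ℝ {v u} ≤ U := by
        have := Submodule.orthogonal_le h
        rw [Submodule.orthogonal_orthogonal, hW, Submodule.orthogonal_orthogonal] at this
        exact this
      have h2 : v u ∈ U := h1 (Submodule.mem_span_singleton_self _)
      have h3 := hv (insert u N) (Finset.insert_subset hu hN)
        ((Finset.card_insert_le _ _).trans (by omega))
      rw [Finset.coe_insert, linearIndepOn_insert (by simpa using huN)] at h3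
      exact h3.2 h2
    · have := Submodule.finrank_mono h
      have := hfin T
      omega
  have := Subspace.biUnion_ne_univ_of_top_notMem hF
  obtain ⟨x, hx⟩ := (Set.ne_univ_iff_exists_notMem _).1 this
  simp only [Set.mem_iUnion, not_exists, F, Finset.mem_union, Finset.mem_image, Finset.mem_sdiff,
    Finset.mem_filter, Finset.mem_powerset] at hx
  refine ⟨x, ?_, ?_, ?_⟩
  · intro u hu
    exact (Submodule.mem_orthogonal _ _).1 x.2 _ (subset_span ⟨u, hu, rfl⟩)
  · intro u hu huN hc
    refine hx _ (Or.inl ⟨u, ⟨hu, huN⟩, rfl⟩) ?_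
    simp only [SetLike.mem_coe, Submodule.mem_comap, Submodule.subtype_apply]
    exact Submodule.mem_orthogonal_singleton_iff_inner_right.2 hc
  · intro T hT hTc hc
    exact hx _ (Or.inr ⟨T, ⟨hT, hTc⟩, rfl⟩) hc

theorem rep {n : ℕ} (G : SimpleGraph (Fin n)) (hG : IsCactus G) (k : ℕ) :
    ∀ S : Finset (Fin n), S.card = k → ∃ v : Fin n → EuclideanSpace ℝ (Fin 5),
      (∀ T ⊆ S, T.card ≤ 3 → LinearIndepOn ℝ v (T : Set (Fin n))) ∧
      ∀ i ∈ S, ∀ j ∈ S, i ≠ j → (inner ℝ (v i) (v j) = 0 ↔ G.Adj i j) := by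
  classical
  induction k with
  | zero =>
    intro S hS
    rw [Finset.card_eq_zero] at hS
    subst hS
    refine ⟨0, fun T hT _ => ?_, by simp⟩
    rw [Finset.subset_empty.1 hT]
    simp
  | succ k ih =>
    intro S hS
    obtain ⟨a, ha, hdeg⟩ := degen G hG S (Finset.card_pos.mp (by omega))
    obtain ⟨v, hv, hadj⟩ := ih (S.erase a) (by rw [Finset.card_erase_of_mem ha]; omega)
    obtain ⟨x, hx1, hx2, hx3⟩ := step G (S.erase a) a ((S.erase a).filter (G.Adj a))
      (Finset.filter_subset _ _) (hdeg _ (by simp; tauto)) v hv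
    have hup : ∀ T : Set (Fin n), a ∉ T → Set.EqOn (Function.update v a x) v T := by
      intro T hT y hy
      rw [Function.update_of_ne]
      rintro rfl
      exact hT hy
    have hin : ∀ i ∈ S, i ≠ a → (inner ℝ (v i) x = 0 ↔ G.Adj i a) := by
      intro i hi hia
      by_cases h : G.Adj a i
      · exact ⟨fun _ => h.symm, fun _ => hx1 i (by simp [*])⟩
      · exact ⟨fun h0 => absurd h0 (hx2 i (by simp [*]) (by simp [*])),
          fun h1 => absurd h1.symm h⟩
    refine ⟨Function.update v a x, ?_, ?_⟩
    · intro T hT hTc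
      by_cases haT : a ∈ T
      · rw [← Finset.insert_erase haT, Finset.coe_insert, linearIndepOn_insert (by simp)]
        have he := hup (T.erase a : Finset _) (by simp)
        have hsub := Finset.erase_subset_erase a hT
        have hc : (T.erase a).card ≤ 2 := by rw [Finset.card_erase_of_mem haT]; omega
        rw [linearIndepOn_congr he, Set.image_congr he, Function.update_self]
        exact ⟨hv _ hsub (by omega), hx3 _ hsub hc⟩
      · rw [linearIndepOn_congr (hup T (by simpa using haT))]
        exact hv T (Finset.subset_erase.2 ⟨hT, haT⟩) hTc
    · intro i hi j hj hij
      by_cases hia : i = a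
      · subst hia
        rw [Function.update_self, Function.update_of_ne hij.symm, real_inner_comm, G.adj_comm]
        exact hin j hj hij.symm
      · by_cases hja : j = a
        · subst hja
          rw [Function.update_self, Function.update_of_ne hij]
          exact hin i hi hij
        · rw [Function.update_of_ne hia, Function.update_of_ne hja]
          exact hadj i (by simp [*]) j (by simp [*]) hij

theorem msr_compl {n : ℕ} (G : SimpleGraph (Fin n)) (hG : IsCactus G) : msr Gᶜ ≤ 5 := by
  obtain ⟨v, -, hv⟩ := rep G hG _ Finset.univ rfl
  let M : Matrix (Fin n) (Fin 5) ℝ := Matrix.of fun i k => v i k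
  have hM : ∀ i j, (M * M.conjTranspose) i j = inner ℝ (v i) (v j) := by
    intro i j
    simp [M, Matrix.mul_apply, PiLp.inner_apply, mul_comm]
  have key : msr Gᶜ ≤ (M * M.conjTranspose).rank := by
    refine Nat.sInf_le ⟨M * M.conjTranspose, Matrix.posSemidef_self_mul_conjTranspose M, ?_, rfl⟩
    intro i j hij
    rw [hM, SimpleGraph.compl_adj, Ne, hv i (by simp) j (by simp) hij]
    tauto
  · refine key.trans ?_
    rw [Matrix.rank_self_mul_conjTranspose]
    simpa using M.rank_le_width

open Matrix in
/-- edge matrix -/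
noncomputable def edgeMat {n : ℕ} : Sym2 (Fin n) → Matrix (Fin n) (Fin n) ℝ :=
  Sym2.lift ⟨fun u v => vecMulVec (Pi.single u 1 - Pi.single v 1) (Pi.single u 1 - Pi.single v 1),
    fun u v => by
      beta_reduce
      ext i j
      simp only [vecMulVec_apply, Pi.sub_apply]
      ring⟩

/-- squared difference along an edge -/
noncomputable def dsq {n : ℕ} (x : Fin n → ℝ) : Sym2 (Fin n) → ℝ :=
  Sym2.lift ⟨fun u v => (x u - x v) ^ 2, fun u v => by ring⟩

theorem dsq_mk {n : ℕ} (x : Fin n → ℝ) (u v : Fin n) : dsq x s(u, v) = (x u - x v) ^ 2 := rfl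

theorem dsq_nonneg {n : ℕ} (x : Fin n → ℝ) (e : Sym2 (Fin n)) : 0 ≤ dsq x e := by
  induction e with | h u v => rw [dsq_mk]; positivity

open Matrix in
theorem edgeMat_quad {n : ℕ} (x : Fin n → ℝ) (e : Sym2 (Fin n)) :
    x ⬝ᵥ (edgeMat e *ᵥ x) = dsq x e := by
  induction e with
  | h u v =>
    rw [dsq_mk]
    simp only [edgeMat, Sym2.lift_mk, vecMulVec_mulVec, dotProduct_smul, dotProduct_sub,
      sub_dotProduct, single_dotProduct, dotProduct_single]
    simp
    ring

open Matrix in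
theorem edgeMat_symm {n : ℕ} (e : Sym2 (Fin n)) : (edgeMat e)ᵀ = edgeMat e := by
  induction e with
  | h u v =>
    simp only [edgeMat, Sym2.lift_mk, transpose_vecMulVec]

open Matrix in
theorem edgeMat_apply {n : ℕ} (e : Sym2 (Fin n)) (he : ¬ e.IsDiag) (i j : Fin n) (hij : i ≠ j) :
    edgeMat e i j = if e = s(i, j) then -1 else 0 := by
  induction e with
  | h u v =>
    simp only [Sym2.mk_isDiag_iff] at he
    simp only [edgeMat, Sym2.lift_mk, vecMulVec_apply, Pi.sub_apply, Pi.single_apply, Sym2.eq_iff]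
    by_cases h1 : i = u <;> by_cases h2 : i = v <;> by_cases h3 : j = u <;> by_cases h4 : j = v <;>
      simp_all [eq_comm]

theorem walk_cs {n : ℕ} {G : SimpleGraph (Fin n)} (x : Fin n → ℝ) {v u : Fin n} (p : G.Walk v u) :
    (x v - x u) ^ 2 ≤ p.length * (p.edges.map (dsq x)).sum := by
  have hn : ∀ {v u : Fin n} (p : G.Walk v u), 0 ≤ (p.edges.map (dsq x)).sum := by
    intro v u p
    apply List.sum_nonneg
    simp only [List.mem_map]
    rintro _ ⟨e, -, rfl⟩
    exact dsq_nonneg x e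
  induction p with
  | nil => simp
  | @cons a b c h q ih =>
    simp only [SimpleGraph.Walk.length_cons, SimpleGraph.Walk.edges_cons, List.map_cons,
      List.sum_cons, dsq_mk]
    push_cast
    have h0 := hn q
    set s := (q.edges.map (dsq x)).sum
    set m : ℝ := (q.length : ℝ) with hm
    have hm0 : 0 ≤ m := by positivity
    rcases hm0.eq_or_lt with h1 | h1
    · rw [← h1] at ih ⊢
      have : x b - x c = 0 := by nlinarith
      have : x c = x b := by linarith
      rw [this]; nlinarith
    · set d := x a - x b
      have hx : x a - x c = d + (x b - x c) := by simp [d]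
      rw [hx]
      set f := x b - x c
      -- (d+f)^2 ≤ (m+1)(d^2 + s), f^2 ≤ m s
      have h2 : (m * d - f) ^ 2 ≥ 0 := sq_nonneg _
      have h3 : m * (d + f) ^ 2 ≤ m * ((m + 1) * (d ^ 2 + s)) := by nlinarith
      exact le_of_mul_le_mul_left h3 h1

/-- potential of a cycle -/
theorem potential {n : ℕ} (G : SimpleGraph (Fin n)) (hG : IsCactus G) (u v : Fin n)
    (h : G.Adj u v) (p : G.Walk v u) (hc : (SimpleGraph.Walk.cons h p).IsCycle) :
    ∃ f : Fin n → ℝ, (∀ e ∈ p.edges, dsq f e = 1) ∧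
      (∀ e ∈ G.edgeSet, e ≠ s(u, v) → e ∉ p.edges → dsq f e = 0) ∧
      f u - f v = p.length := by
  classical
  have hc' := hc
  rw [SimpleGraph.Walk.cons_isCycle_iff] at hc'
  obtain ⟨hp, huv⟩ := hc'
  let H : Sym2 (Fin n) → SimpleGraph (Fin n) := fun e => G.deleteEdges {s(u, v), e}
  let t : G.Dart → Fin n → ℝ := fun d z => if (H d.edge).Reachable d.fst z then 0 else 1
  have ht : ∀ (d : G.Dart) (y z : Fin n), G.Adj y z → s(y, z) ≠ s(u, v) → s(y, z) ≠ d.edge →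
      t d y = t d z := by
    intro d y z hyz h1 h2
    have hadj : (H d.edge).Adj y z := by
      simp only [H, SimpleGraph.deleteEdges_adj]
      exact ⟨hyz, by simp only [Set.mem_insert_iff, Set.mem_singleton_iff]; tauto⟩
    have : (H d.edge).Reachable d.fst y ↔ (H d.edge).Reachable d.fst z :=
      ⟨fun h => h.trans hadj.reachable, fun h => h.trans hadj.symm.reachable⟩
    simp only [t, this]
  have ht1 : ∀ d ∈ p.darts, t d d.snd - t d d.fst = 1 := by
    intro d hd
    have hde : d.edge ∈ p.edges := List.mem_map_of_mem hd
    have hne : d.edge ≠ s(u, v) := fun h => huv (h ▸ hde)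
    have : ¬ (H d.edge).Reachable d.fst d.snd := by
      have hin : s(d.fst, d.snd) ∈ (G.deleteEdges {s(u, v)}).edgeSet := by
        rw [SimpleGraph.edgeSet_deleteEdges]
        exact ⟨d.adj, hne⟩
      have hb := (SimpleGraph.isBridge_iff_forall_cycle_notMem hin).2 (by
        intro w q hq hqe
        have hle := SimpleGraph.deleteEdges_le (G := G) {s(u, v)}
        have hm := (hG.2 _ _ _ _ hc (hq.mapLe hle) d.edge (by simp [hde])
          (by rw [SimpleGraph.Walk.edges_mapLe_eq_edges]; exact hqe) s(u, v)).1 (by simp)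
        rw [SimpleGraph.Walk.edges_mapLe_eq_edges] at hm
        have := q.edges_subset_edgeSet hm
        rw [SimpleGraph.edgeSet_deleteEdges] at this
        exact this.2 rfl)
      rw [SimpleGraph.isBridge_iff, SimpleGraph.deleteEdges_deleteEdges] at hb
      exact hb
    simp [t, this]
  have hnd : p.edges.Nodup := hp.isTrail.edges_nodup
  have hnd' : p.darts.Nodup := List.Nodup.of_map _ hnd
  let f : Fin n → ℝ := fun z => ∑ d ∈ p.darts.toFinset, t d z
  have hf1 : ∀ d ∈ p.darts, f d.snd - f d.fst = 1 := by
    intro d hd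
    simp only [f]
    rw [← Finset.sum_sub_distrib, Finset.sum_eq_single d, ht1 d hd]
    · intro d' hd' hne
      rw [List.mem_toFinset] at hd'
      rw [sub_eq_zero, eq_comm]
      refine ht d' _ _ d.adj ?_ ?_
      · intro h
        exact huv (h ▸ List.mem_map_of_mem hd)
      · intro h
        exact hne (List.inj_on_of_nodup_map hnd hd' hd h.symm)
    · simp [hd]
  have htel : ∀ {a b : Fin n} (q : G.Walk a b), (∀ d ∈ q.darts, f d.snd - f d.fst = 1) →
      f b - f a = q.length := by
    intro a b q
    induction q with
    | nil => simp
    | cons h q ih =>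
      intro hq
      simp only [SimpleGraph.Walk.darts_cons, List.mem_cons, forall_eq_or_imp] at hq
      have h1 := ih hq.2
      have h2 := hq.1
      simp only [SimpleGraph.Walk.length_cons]
      push_cast
      linarith
  refine ⟨f, ?_, ?_, htel p hf1⟩
  · intro e he
    obtain ⟨d, hd, rfl⟩ := List.mem_map.1 he
    have := hf1 d hd
    change (f d.fst - f d.snd) ^ 2 = 1
    rw [← neg_sub, this]; norm_num
  · intro e he hne hep
    induction e with
    | h y z =>
      have : f y = f z := by
        refine Finset.sum_congr rfl fun d hd => ht d y z he hne ?_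
        rintro h
        rw [List.mem_toFinset] at hd
        exact hep (h ▸ List.mem_map_of_mem hd)
      rw [dsq_mk, this]; simp

theorem two_cycles {n : ℕ} (G : SimpleGraph (Fin n)) [DecidableRel G.Adj] (hG : G.Connected)
    (hE : n + 1 ≤ G.edgeFinset.card) :
    ∃ (u v : Fin n) (h : G.Adj u v) (p : G.Walk v u) (u' v' : Fin n) (h' : G.Adj u' v')
      (p' : G.Walk v' u'), (SimpleGraph.Walk.cons h p).IsCycle ∧
      (SimpleGraph.Walk.cons h' p').IsCycle ∧ s(u, v) ∉ (SimpleGraph.Walk.cons h' p').edges := by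
  classical
  have hac : ∀ (H : SimpleGraph (Fin n)) [Fintype H.edgeSet], H.Connected → n ≤ H.edgeFinset.card →
      ∃ (u v : Fin n) (h : H.Adj u v) (p : H.Walk v u), (SimpleGraph.Walk.cons h p).IsCycle := by
    intro H _ hH hc
    by_contra! hno
    have hT : H.IsTree := ⟨hH, by
      intro u p hp
      cases p with
      | nil => exact absurd hp (by simp)
      | cons h q => exact hno _ _ h q hp⟩
    have := hT.card_edgeFinset
    simp at this
    omega
  obtain ⟨u, v, h, p, hp⟩ := hac G hG (Nat.le_of_succ_le hE)
  have hnb : ¬ G.IsBridge s(u, v) := by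
    intro hb
    exact (SimpleGraph.isBridge_iff_forall_cycle_notMem h).1 hb _ hp (by simp)
  have hconn := hG.connected_delete_edge_of_not_isBridge hnb
  have hle := SimpleGraph.deleteEdges_le (G := G) {s(u, v)}
  obtain ⟨u', v', h', p', hp'⟩ := hac _ hconn (by
    have h1 : (G.deleteEdges {s(u, v)}).edgeFinset = G.edgeFinset.erase s(u, v) := by
      ext e
      simp [SimpleGraph.edgeSet_deleteEdges, and_comm]
    rw [h1, Finset.card_erase_of_mem (by simpa using h)]
    omega)
  refine ⟨u, v, h, p, u', v', hle h', p'.mapLe hle, hp, hp'.mapLe hle, ?_⟩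
  have := (SimpleGraph.Walk.cons h' p').edges_subset_edgeSet (e := s(u, v))
  intro hc
  have h4 : s(u, v) ∈ (SimpleGraph.Walk.cons h' p').edges := by
    rw [SimpleGraph.Walk.edges_cons, SimpleGraph.Walk.edges_mapLe_eq_edges] at hc
    exact hc
  have := this h4
  rw [SimpleGraph.edgeSet_deleteEdges] at this
  exact this.2 rfl

open Matrix in
theorem msr_le {n : ℕ} (G : SimpleGraph (Fin n)) [DecidableRel G.Adj] (hG : IsCactus G)
    (hE : n + 1 ≤ G.edgeFinset.card) : msr G + 3 ≤ n := by
  classical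
  obtain ⟨u, v, h, p, u', v', h', p', hc, hc', hne⟩ := two_cycles G hG.1 hE
  have hd : ∀ e ∈ (SimpleGraph.Walk.cons h p).edges,
      e ∉ (SimpleGraph.Walk.cons h' p').edges := by
    intro e he he'
    exact hne ((hG.2 _ _ _ _ hc hc' e he he' s(u, v)).1 (by simp))
  obtain ⟨f, hf1, hf0, hf⟩ := potential G hG u v h p hc
  obtain ⟨g, hg1, hg0, hg⟩ := potential G hG u' v' h' p' hc'
  have hcc := hc
  have hcc' := hc'
  rw [SimpleGraph.Walk.cons_isCycle_iff] at hcc hcc'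
  obtain ⟨hp, huv⟩ := hcc
  obtain ⟨hp', huv'⟩ := hcc'
  simp only [SimpleGraph.Walk.edges_cons, List.mem_cons, forall_eq_or_imp, not_or] at hd hne
  obtain ⟨⟨hee, hep'⟩, hd⟩ := hd
  have hlen : ∀ {a b : Fin n} (q : G.Walk b a), G.Adj a b → (0 : ℝ) < q.length := by
    intro a b q hab
    cases q with
    | nil => exact absurd hab G.irrefl
    | cons _ _ => simp; positivity
  have hm := hlen p h
  have hm' := hlen p' h'
  set m : ℝ := (p.length : ℝ) with hmdef
  set m' : ℝ := (p'.length : ℝ) with hmdef'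
  set e₁ := s(u, v) with he1
  set e₂ := s(u', v') with he2
  let w : Sym2 (Fin n) → ℝ := fun e =>
    1 - (if e = e₁ then 1 + 1 / m else 0) - (if e = e₂ then 1 + 1 / m' else 0)
  let A : Matrix (Fin n) (Fin n) ℝ := ∑ e ∈ G.edgeFinset, w e • edgeMat e
  have he1E : e₁ ∈ G.edgeFinset := by simpa [he1] using h
  have he2E : e₂ ∈ G.edgeFinset := by simpa [he2] using h'
  have hq : ∀ x, x ⬝ᵥ (A *ᵥ x) = ∑ e ∈ G.edgeFinset, dsq x e - (1 + 1 / m) * dsq x e₁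
      - (1 + 1 / m') * dsq x e₂ := by
    intro x
    simp only [A, Matrix.sum_mulVec, dotProduct_sum, smul_mulVec, dotProduct_smul, edgeMat_quad,
      smul_eq_mul, w, sub_mul, ite_mul, zero_mul, one_mul, Finset.sum_sub_distrib,
      Finset.sum_ite_eq', he1E, he2E, if_true]
  have hsum : ∀ (x : Fin n → ℝ) {a b : Fin n} (q : G.Walk a b), q.IsPath →
      ∑ e ∈ q.edges.toFinset, dsq x e = (q.edges.map (dsq x)).sum := by
    intro x a b q hq
    exact List.sum_toFinset _ hq.isTrail.edges_nodup
  have hdis1 : e₁ ∉ p.edges.toFinset := by simpa using huv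
  have hdis2 : e₂ ∉ p'.edges.toFinset := by simpa using huv'
  have hdis : Disjoint (insert e₁ p.edges.toFinset) (insert e₂ p'.edges.toFinset) := by
    rw [Finset.disjoint_left]
    simp only [Finset.mem_insert, List.mem_toFinset, not_or]
    rintro e (rfl | he)
    · exact ⟨hee, hep'⟩
    · exact hd e he
  have hnn : ∀ x, 0 ≤ x ⬝ᵥ (A *ᵥ x) := by
    intro x
    rw [hq]
    have hsub : insert e₁ p.edges.toFinset ∪ insert e₂ p'.edges.toFinset ⊆ G.edgeFinset := by
      intro e he
      simp only [Finset.mem_union, Finset.mem_insert, List.mem_toFinset] at he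
      rcases he with (rfl | he) | (rfl | he)
      · exact he1E
      · simpa using p.edges_subset_edgeSet he
      · exact he2E
      · simpa using p'.edges_subset_edgeSet he
    have h1 := Finset.sum_le_sum_of_subset_of_nonneg hsub (f := dsq x)
      (fun e _ _ => dsq_nonneg x e)
    rw [Finset.sum_union hdis, Finset.sum_insert hdis1, Finset.sum_insert hdis2,
      hsum x p hp, hsum x p' hp'] at h1
    have h2 : dsq x e₁ / m ≤ (p.edges.map (dsq x)).sum := by
      rw [div_le_iff₀' hm]
      have := walk_cs x p
      rw [he1, Sym2.eq_swap, dsq_mk]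
      exact this
    have h3 : dsq x e₂ / m' ≤ (p'.edges.map (dsq x)).sum := by
      rw [div_le_iff₀' hm']
      have := walk_cs x p'
      rw [he2, Sym2.eq_swap, dsq_mk]
      exact this
    have h4 : (1 + 1 / m) * dsq x e₁ = dsq x e₁ + dsq x e₁ / m := by ring
    have h5 : (1 + 1 / m') * dsq x e₂ = dsq x e₂ + dsq x e₂ / m' := by ring
    rw [h4, h5]
    linarith
  have hpsd : A.PosSemidef := by
    refine Matrix.PosSemidef.of_dotProduct_mulVec_nonneg ?_ (fun x => by simpa using hnn x)
    rw [Matrix.IsHermitian, conjTranspose_eq_transpose_of_trivial]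
    simp only [A, transpose_sum, transpose_smul, edgeMat_symm]
  have hcount : ∀ (x : Fin n → ℝ) (e₀ : Sym2 (Fin n)) {a b : Fin n} (q : G.Walk a b), q.IsPath →
      e₀ ∉ q.edges → e₀ ∈ G.edgeFinset → (∀ e ∈ q.edges, dsq x e = 1) →
      (∀ e ∈ G.edgeSet, e ≠ e₀ → e ∉ q.edges → dsq x e = 0) →
      ∑ e ∈ G.edgeFinset, dsq x e = dsq x e₀ + q.length := by
    intro x e₀ a b q hq h0 h0E h1 h2
    have hsub : insert e₀ q.edges.toFinset ⊆ G.edgeFinset := by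
      intro e he
      simp only [Finset.mem_insert, List.mem_toFinset] at he
      rcases he with rfl | he
      · exact h0E
      · simpa using q.edges_subset_edgeSet he
    rw [← Finset.sum_subset hsub, Finset.sum_insert (by simpa using h0)]
    · congr 1
      rw [Finset.sum_congr rfl (g := fun _ => (1 : ℝ)) (fun e he => h1 e (by simpa using he))]
      simp [List.toFinset_card_of_nodup hq.isTrail.edges_nodup]
    · intro e he hn
      simp only [Finset.mem_insert, List.mem_toFinset, not_or] at hn
      exact h2 e (by simpa using he) hn.1 hn.2
  have hkf : A *ᵥ f = 0 := by
    rw [← hpsd.dotProduct_mulVec_zero_iff]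
    rw [star_trivial, hq, hcount f e₁ p hp huv he1E hf1 hf0]
    rw [hf0 e₂ (by simpa using he2E) (Ne.symm hee) (fun hc => (hd _ hc).1 rfl)]
    rw [he1, dsq_mk, hf]
    field_simp
    ring
  have hkg : A *ᵥ g = 0 := by
    rw [← hpsd.dotProduct_mulVec_zero_iff]
    rw [star_trivial, hq, hcount g e₂ p' hp' huv' he2E hg1 hg0]
    rw [hg0 e₁ (by simpa using he1E) hee hep']
    rw [he2, dsq_mk, hg]
    field_simp
    ring
  have hone : ∀ e, dsq (1 : Fin n → ℝ) e = 0 := by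
    intro e
    induction e with | h a b => simp [dsq_mk]
  have hk1 : A *ᵥ 1 = 0 := by
    rw [← hpsd.dotProduct_mulVec_zero_iff, star_trivial, hq]
    simp [hone]
  have hli : LinearIndependent ℝ ![f, g, (1 : Fin n → ℝ)] := by
    have hfc : f u' - f v' = 0 := by
      have := hf0 e₂ (by simpa using he2E) (Ne.symm hee) (fun hc => (hd _ hc).1 rfl)
      rw [he2, dsq_mk] at this
      exact pow_eq_zero_iff (two_ne_zero) |>.1 this
    have hgc : g u - g v = 0 := by
      have := hg0 e₁ (by simpa using he1E) hee hep'
      rw [he1, dsq_mk] at this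
      exact pow_eq_zero_iff (two_ne_zero) |>.1 this
    rw [Fintype.linearIndependent_iff]
    intro c hc0
    have hz : ∀ z, c 0 * f z + c 1 * g z + c 2 = 0 := by
      intro z
      have := congrFun hc0 z
      simpa [Fin.sum_univ_three] using this
    have c0 : c 0 = 0 := by
      have : c 0 * m = 0 := by
        rw [← hf]
        linear_combination hz u - hz v - c 1 * hgc
      exact (mul_eq_zero.1 this).resolve_right hm.ne'
    have c1 : c 1 = 0 := by
      have : c 1 * m' = 0 := by
        rw [← hg]
        linear_combination hz u' - hz v' - c 0 * hfc
      exact (mul_eq_zero.1 this).resolve_right hm'.ne'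
    have c2 : c 2 = 0 := by
      have := hz u
      rw [c0, c1] at this
      linarith
    intro i
    fin_cases i
    · exact c0
    · exact c1
    · exact c2
  have hrank : A.rank + 3 ≤ n := by
    have h1 := LinearMap.finrank_range_add_finrank_ker A.mulVecLin
    have h2 : 3 ≤ Module.finrank ℝ (LinearMap.ker A.mulVecLin) := by
      have h3 : Submodule.span ℝ (Set.range ![f, g, (1 : Fin n → ℝ)]) ≤
          LinearMap.ker A.mulVecLin := by
        rw [Submodule.span_le]
        rintro _ ⟨i, rfl⟩
        fin_cases i <;> simp [hkf, hkg, hk1]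
      have h4 := Submodule.finrank_mono h3
      rw [finrank_span_eq_card hli] at h4
      simpa using h4
    rw [Module.finrank_fin_fun] at h1
    have : A.rank = Module.finrank ℝ (LinearMap.range A.mulVecLin) := rfl
    omega
  have hle : msr G ≤ A.rank := by
    refine Nat.sInf_le ⟨A, hpsd, ?_, rfl⟩
    intro i j hij
    have hA : A i j = ∑ e ∈ G.edgeFinset, if e = s(i, j) then - w e else 0 := by
      simp only [A, Matrix.sum_apply, Matrix.smul_apply, smul_eq_mul]
      refine Finset.sum_congr rfl fun e he => ?_
      rw [edgeMat_apply e (G.not_isDiag_of_mem_edgeFinset he) i j hij]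
      split_ifs <;> simp
    rw [hA, Finset.sum_ite_eq']
    have hw : ∀ e, w e ≠ 0 := by
      intro e
      have i1 : 0 < 1 / m := by positivity
      have i2 : 0 < 1 / m' := by positivity
      simp only [w]
      split_ifs with h1 h2
      · exact absurd (h1.symm.trans h2) hee
      · linarith
      · linarith
      · norm_num
    by_cases hadj : G.Adj i j <;> simp [hadj, hw]
  omega

/-- A cactus graph with at least two cycles (equivalently, connected with
`|E| ≥ |V| + 1`) satisfies the positive semidefinite graph complement conjecture:
`msr(G) + msr(Ḡ) ≤ |G| + 2`. -/
theorem cactus_two_cycles_gcc_plus {n : ℕ}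
    (G : SimpleGraph (Fin n)) [DecidableRel G.Adj] (hG : IsCactus G)
    (hE : n + 1 ≤ G.edgeFinset.card) :
    msr G + msr Gᶜ ≤ n + 2 := by
  have h1 := msr_le G hG hE
  have h2 := msr_compl G hG
  omega
end

section
/- Let G = (V, E) be a cactus graph. Then G satisfies the positive semidefinite graph complement conjecture: msr(G) + msr(Ḡ) ≤ |G| + 2. -/
lemma aux_rank_le {n : ℕ} (A : Matrix (Fin n) (Fin n) ℝ) {m : ℕ} (f : Fin m → (Fin n → ℝ))
    (hf : LinearIndependent ℝ f) (h : ∀ i, A.mulVec (f i) = 0) : A.rank + m ≤ n := by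
  have h1 := LinearMap.finrank_range_add_finrank_ker A.mulVecLin
  have h2 : m ≤ Module.finrank ℝ (LinearMap.ker A.mulVecLin) := by
    let g : Fin m → LinearMap.ker A.mulVecLin := fun i => ⟨f i, by simpa using h i⟩
    have hg : LinearIndependent ℝ g :=
      LinearIndependent.of_comp (LinearMap.ker A.mulVecLin).subtype (by simpa [Function.comp_def, g] using hf)
    simpa using hg.fintype_card_le_finrank
  have h3 : A.rank = Module.finrank ℝ (LinearMap.range A.mulVecLin) := rfl
  simp only [Module.finrank_fin_fun] at h1
  omega

lemma aux_msr_le {n : ℕ} (G : SimpleGraph (Fin n)) (A : Matrix (Fin n) (Fin n) ℝ)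
    (hA : A.PosSemidef) (h : ∀ i j : Fin n, i ≠ j → (A i j ≠ 0 ↔ G.Adj i j)) : msr G ≤ A.rank :=
  Nat.sInf_le ⟨A, hA, h, rfl⟩

lemma aux_lap_off {n : ℕ} (G : SimpleGraph (Fin n)) [DecidableRel G.Adj] (i j : Fin n) (h : i ≠ j) :
    G.lapMatrix ℝ i j = if G.Adj i j then -1 else 0 := by
  simp only [SimpleGraph.lapMatrix, SimpleGraph.degMatrix, Matrix.sub_apply,
    Matrix.diagonal_apply_ne _ h, SimpleGraph.adjMatrix_apply]
  split_ifs <;> simp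

lemma aux_msr_conn {n : ℕ} (G : SimpleGraph (Fin n)) (hn : 0 < n) : msr G + 1 ≤ n := by
  classical
  have h1 := aux_msr_le G (G.lapMatrix ℝ) (G.posSemidef_lapMatrix ℝ) (by
    intro i j h; rw [aux_lap_off G i j h]; simp)
  have h2 := aux_rank_le (G.lapMatrix ℝ) (m := 1) (fun _ => fun _ => 1)
    (by
      rw [linearIndependent_unique_iff]
      intro h
      have := congrFun h ⟨0, hn⟩
      simp at this)
    (fun _ => G.lapMatrix_mulVec_const_eq_zero)
  omega

lemma aux_solve {n : ℕ} (G : SimpleGraph (Fin n)) [DecidableRel G.Adj] (hG : G.Connected)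
    (b : Fin n → ℝ) (hb : ∑ i, b i = 0) : ∃ z, (G.lapMatrix ℝ).mulVec z = b := by
  have hn : (n : ℝ) ≠ 0 := by
    obtain ⟨x⟩ := hG.nonempty
    have := x.pos
    positivity
  have hsum : ∀ x : Fin n → ℝ, ∑ i, (G.lapMatrix ℝ).mulVec x i = 0 := by
    intro x
    have : (fun _ => (1:ℝ)) ⬝ᵥ (G.lapMatrix ℝ).mulVec x = 0 := by
      rw [Matrix.dotProduct_mulVec, ← Matrix.mulVec_transpose, (G.isSymm_lapMatrix (R := ℝ)).eq]
      have h := G.lapMatrix_mulVec_const_eq_zero (R := ℝ)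
      rw [h]; simp
    simpa [dotProduct] using this
  let T : (Fin n → ℝ) →ₗ[ℝ] (Fin n → ℝ) :=
    (G.lapMatrix ℝ).mulVecLin + LinearMap.pi (fun _ => ∑ i, LinearMap.proj i)
  have hT : ∀ x j, T x j = (G.lapMatrix ℝ).mulVec x j + ∑ i, x i := by
    intro x j; simp [T]
  have hTs : ∀ x, ∑ j, T x j = n * ∑ i, x i := by
    intro x
    simp only [hT, Finset.sum_add_distrib, hsum]
    simp
  have key : ∀ x, ∑ j, T x j = 0 → ∑ i, x i = 0 := by
    intro x hx
    rw [hTs] at hx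
    simpa [hn] using hx
  have inj : Function.Injective T := by
    rw [injective_iff_map_eq_zero]
    intro x hx
    have h0 := key x (by simp [hx])
    have hL : (G.lapMatrix ℝ).mulVec x = 0 := by
      ext j
      have := hT x j
      rw [hx, h0] at this
      simpa using this.symm
    rw [G.lapMatrix_mulVec_eq_zero_iff_forall_reachable] at hL
    ext j
    have : ∑ i, x i = n * x j := by
      rw [Finset.sum_congr rfl (fun i _ => hL i j (hG.preconnected i j))]
      simp
    rw [h0] at this
    have := this.symm
    simpa [hn] using this
  obtain ⟨z, hz⟩ := LinearMap.injective_iff_surjective.mp inj b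
  refine ⟨z, ?_⟩
  have h0 := key z (by rw [hz]; exact hb)
  ext j
  rw [← hz, hT, h0, add_zero]

lemma aux_msr_cycle {n : ℕ} (G : SimpleGraph (Fin n)) (hG : G.Connected) (hc : ¬ G.IsAcyclic) :
    msr G + 2 ≤ n := by
  classical
  rw [SimpleGraph.isAcyclic_iff_forall_adj_isBridge] at hc
  push Not at hc
  obtain ⟨a, b, hab, hbr⟩ := hc
  have hH := hG.connected_delete_edge_of_not_isBridge hbr
  set H := G.deleteEdges {s(a, b)} with hHdef
  have hne : a ≠ b := hab.ne
  let β : Fin n → ℝ := Pi.single a 1 - Pi.single b 1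
  have hβa : β a = 1 := by simp [β, hne]
  have hβ : ∑ i, β i = 0 := by simp [β]
  obtain ⟨z, hz⟩ := aux_solve H hH β hβ
  have hsym : ∀ x y : Fin n → ℝ, x ⬝ᵥ (H.lapMatrix ℝ).mulVec y = y ⬝ᵥ (H.lapMatrix ℝ).mulVec x := by
    intro x y
    rw [Matrix.dotProduct_mulVec, ← Matrix.mulVec_transpose, (H.isSymm_lapMatrix (R := ℝ)).eq, dotProduct_comm]
  have hpsd : ∀ x : Fin n → ℝ, 0 ≤ x ⬝ᵥ (H.lapMatrix ℝ).mulVec x := by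
    intro x
    simpa using (H.posSemidef_lapMatrix ℝ).dotProduct_mulVec_nonneg x
  set q := z ⬝ᵥ β with hq
  have hq0 : q ≠ 0 := by
    intro h
    have h1 : (H.lapMatrix ℝ).mulVec z = 0 := by
      rw [← (H.posSemidef_lapMatrix ℝ).dotProduct_mulVec_zero_iff]
      simpa [hz] using h
    rw [hz] at h1
    rw [h1] at hβa
    simp at hβa
  have hqpos : 0 < q := lt_of_le_of_ne (by have := hpsd z; rwa [hz] at this) (Ne.symm hq0)
  let A : Matrix (Fin n) (Fin n) ℝ := H.lapMatrix ℝ - q⁻¹ • Matrix.vecMulVec β β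
  have hAx : ∀ x, A.mulVec x = (H.lapMatrix ℝ).mulVec x - (q⁻¹ * (β ⬝ᵥ x)) • β := by
    intro x
    simp only [A, Matrix.sub_mulVec, Matrix.smul_mulVec, Matrix.vecMulVec_mulVec]
    ext i; simp; ring
  have hA : A.PosSemidef := by
    refine Matrix.PosSemidef.of_dotProduct_mulVec_nonneg ?_ ?_
    · refine (H.posSemidef_lapMatrix ℝ).1.sub ?_
      ext i j
      simp [Matrix.vecMulVec_apply, mul_comm]
    · intro x
      rw [star_trivial, hAx, dotProduct_sub, dotProduct_smul, smul_eq_mul]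
      have h1 := hpsd (x - (q⁻¹ * (β ⬝ᵥ x)) • z)
      have h2 := hsym z x
      rw [Matrix.mulVec_sub, Matrix.mulVec_smul, hz] at h1
      rw [hz] at h2
      simp only [sub_dotProduct, dotProduct_sub, smul_dotProduct, dotProduct_smul, smul_eq_mul] at h1
      rw [h2, ← hq] at h1
      rw [dotProduct_comm β x] at *
      have h3 : q⁻¹ * q = 1 := inv_mul_cancel₀ hq0
      have : q⁻¹ * x ⬝ᵥ β * (q⁻¹ * x ⬝ᵥ β * q) = q⁻¹ * x ⬝ᵥ β * x ⬝ᵥ β := by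
        rw [show q⁻¹ * x ⬝ᵥ β * (q⁻¹ * x ⬝ᵥ β * q) = (q⁻¹ * q) * (q⁻¹ * x ⬝ᵥ β * x ⬝ᵥ β) by ring, h3, one_mul]
      linarith
  have hpat : ∀ i j : Fin n, i ≠ j → (A i j ≠ 0 ↔ G.Adj i j) := by
    intro i j hij
    have e1 : A i j = (if H.Adj i j then -1 else 0) - q⁻¹ * (β i * β j) := by
      simp only [A, Matrix.sub_apply, aux_lap_off H i j hij, Matrix.smul_apply,
        Matrix.vecMulVec_apply, smul_eq_mul]
    rw [e1]
    have hHij : H.Adj i j ↔ G.Adj i j ∧ s(i,j) ≠ s(a,b) := by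
      simp [H, SimpleGraph.deleteEdges_adj]
    by_cases hs : s(i,j) = s(a,b)
    · have : ¬ H.Adj i j := by simp [hHij, hs]
      have hG' : G.Adj i j := by rw [← SimpleGraph.mem_edgeSet, hs]; exact hab
      have : β i * β j = -1 := by
        rcases Sym2.eq_iff.mp hs with ⟨rfl, rfl⟩ | ⟨rfl, rfl⟩ <;> simp [β, hij, hij.symm]
      rw [this]; simp [hHij, hs, hG', hq0]
    · have : β i * β j = 0 := by
        have h' : ∀ k, k ≠ a → k ≠ b → β k = 0 := by
          intro k h1 h2; simp [β, h1, h2]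
        by_contra hcon
        have hi : β i ≠ 0 := left_ne_zero_of_mul hcon
        have hj : β j ≠ 0 := right_ne_zero_of_mul hcon
        apply hs
        rw [Sym2.eq_iff]
        have := h' i; have := h' j
        grind
      rw [this]
      simp [hHij, hs]
  have h1 := aux_msr_le G A hA hpat
  have h2 := aux_rank_le A (m := 2) ![fun _ => 1, z] (by
      rw [LinearIndependent.pair_iff]
      intro s t hst
      have h0 : t = 0 := by
        have h := congrArg (H.lapMatrix ℝ).mulVec hst
        have hc := H.lapMatrix_mulVec_const_eq_zero (R := ℝ)
        rw [Matrix.mulVec_add, Matrix.mulVec_smul, Matrix.mulVec_smul, hz, hc] at h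
        have := congrFun h a
        simpa [hβa] using this
      have := congrFun hst a
      refine ⟨?_, h0⟩
      simpa [h0] using this) (by
      intro i
      fin_cases i
      · have hc := H.lapMatrix_mulVec_const_eq_zero (R := ℝ)
        have hs : β ⬝ᵥ (fun _ => (1:ℝ)) = 0 := by simpa [dotProduct] using hβ
        simp only [Fin.zero_eta, Matrix.cons_val_zero]
        rw [hAx, hc, hs]; simp
      · simp only [Fin.mk_one, Matrix.cons_val_one, Matrix.cons_val_fin_one]
        rw [hAx, hz, dotProduct_comm, ← hq, inv_mul_cancel₀ hq0]; simp)
  omega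

lemma aux_longest {n : ℕ} (G : SimpleGraph (Fin n)) (S : Finset (Fin n)) (hS : S.Nonempty) :
    ∃ (w u : Fin n) (p : G.Walk w u), p.IsPath ∧ (∀ x ∈ p.support, x ∈ S) ∧
      ∀ x ∈ S, G.Adj w x → x ∈ p.support := by
  classical
  obtain ⟨s, hs⟩ := hS
  let P : ℕ → Prop := fun k => ∃ (w u : Fin n) (p : G.Walk w u), p.IsPath ∧
    (∀ x ∈ p.support, x ∈ S) ∧ p.length = k
  have h0 : P 0 := ⟨s, s, .nil, .nil, by simpa using hs, rfl⟩
  have hb : ∀ k, P k → k ≤ n := by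
    rintro k ⟨w, u, p, hp, -, rfl⟩
    have := hp.length_lt
    simp at this; omega
  have hm := Nat.findGreatest_spec (P := P) (Nat.zero_le n) h0
  obtain ⟨w, u, p, hp, hpS, hl⟩ := hm
  refine ⟨w, u, p, hp, hpS, fun x hx hadj => ?_⟩
  by_contra hcon
  have hP : P (p.length + 1) := ⟨x, u, .cons hadj.symm p, hp.cons hcon, by
    intro y hy
    rw [SimpleGraph.Walk.support_cons, List.mem_cons] at hy
    rcases hy with rfl | hy
    · exact hx
    · exact hpS y hy, rfl⟩
  have := Nat.le_findGreatest (hb _ hP) hP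
  omega

lemma aux_cyc {n : ℕ} {G : SimpleGraph (Fin n)} {w v u : Fin n} (h : G.Adj w v) (p : G.Walk v u)
    (hp : (SimpleGraph.Walk.cons h p).IsPath) (x : Fin n) (hx : x ∈ p.support) (hwx : G.Adj w x)
    (hxv : x ≠ v) : ∃ c : G.Walk w w, c.IsCycle ∧ s(w, v) ∈ c.edges ∧ s(w, x) ∈ c.edges ∧
      ∀ y, s(w, y) ∈ c.edges → y = v ∨ y = x := by
  classical
  rw [SimpleGraph.Walk.cons_isPath_iff] at hp
  have hw : w ∉ (p.takeUntil x hx).support := fun hh => hp.2 (p.support_takeUntil_subset_support hx hh)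
  have hed : ∀ y, s(w,y) ∉ (p.takeUntil x hx).edges := fun y hy =>
    hw (SimpleGraph.Walk.fst_mem_support_of_mem_edges _ hy)
  have hed' : ∀ y, s(y,w) ∉ (p.takeUntil x hx).edges := fun y hy =>
    hw (SimpleGraph.Walk.snd_mem_support_of_mem_edges _ hy)
  have hne := hwx.ne
  refine ⟨.cons h ((p.takeUntil x hx).concat hwx.symm), ?_, ?_, ?_, ?_⟩
  · rw [SimpleGraph.Walk.cons_isCycle_iff]
    refine ⟨(hp.1.takeUntil hx).concat hw _, ?_⟩
    simp only [SimpleGraph.Walk.edges_concat, List.concat_eq_append, List.mem_append, hed]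
    simp [hne, Ne.symm hxv]
  · simp
  · simp [Sym2.eq_swap]
  · intro y hy
    simp only [SimpleGraph.Walk.edges_cons, SimpleGraph.Walk.edges_concat, List.concat_eq_append, List.mem_append, List.mem_cons, hed] at hy
    simp at hy
    grind

lemma aux_deg1 {n : ℕ} (G : SimpleGraph (Fin n)) [DecidableRel G.Adj] (hG : G.IsAcyclic)
    (S : Finset (Fin n)) (hS : S.Nonempty) : ∃ w ∈ S, (S.filter (G.Adj w)).card ≤ 1 := by
  obtain ⟨w, u, p, hp, hpS, hmax⟩ := aux_longest G S hS
  refine ⟨w, hpS w (by simp), ?_⟩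
  cases p with
  | nil =>
    rw [Finset.filter_false_of_mem]; · simp
    intro x hx hadj
    have := hmax x hx hadj
    simp at this
    exact hadj.ne this.symm
  | @cons _ v _ h p =>
    have : S.filter (G.Adj w) ⊆ {v} := by
      intro x hx
      rw [Finset.mem_filter] at hx
      rw [Finset.mem_singleton]
      by_contra hxv
      have hm := hmax x hx.1 hx.2
      rw [SimpleGraph.Walk.support_cons, List.mem_cons] at hm
      obtain ⟨c, hc, -⟩ := aux_cyc h p hp x (hm.resolve_left hx.2.ne.symm) hx.2 hxv
      exact hG c hc
    simpa using Finset.card_le_card this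

lemma aux_deg2 {n : ℕ} (G : SimpleGraph (Fin n)) [DecidableRel G.Adj] (hG : IsCactus G)
    (S : Finset (Fin n)) (hS : S.Nonempty) : ∃ w ∈ S, (S.filter (G.Adj w)).card ≤ 2 := by
  obtain ⟨w, u, p, hp, hpS, hmax⟩ := aux_longest G S hS
  refine ⟨w, hpS w (by simp), ?_⟩
  cases p with
  | nil =>
    rw [Finset.filter_false_of_mem]; · simp
    intro x hx hadj
    have := hmax x hx hadj
    simp at this
    exact hadj.ne this.symm
  | @cons _ v _ h p =>
    have key : ((S.filter (G.Adj w)).erase v).card ≤ 1 := by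
      rw [Finset.card_le_one]
      intro x hx y hy
      simp only [Finset.mem_erase, Finset.mem_filter] at hx hy
      have hm := hmax x hx.2.1 hx.2.2
      have hm' := hmax y hy.2.1 hy.2.2
      rw [SimpleGraph.Walk.support_cons, List.mem_cons] at hm hm'
      obtain ⟨c, hc, h1, h2, h3⟩ := aux_cyc h p hp x (hm.resolve_left hx.2.2.ne.symm) hx.2.2 hx.1
      obtain ⟨d, hd, k1, k2, k3⟩ := aux_cyc h p hp y (hm'.resolve_left hy.2.2.ne.symm) hy.2.2 hy.1
      have := (hG.2 w w c d hc hd _ h1 k1 s(w,x)).1 h2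
      exact (k3 x this).resolve_left hx.1
    have := Finset.pred_card_le_card_erase (s := S.filter (G.Adj w)) (a := v)
    omega

lemma aux_k23 {n : ℕ} (G : SimpleGraph (Fin n)) (hG : IsCactus G) (a b x y z : Fin n)
    (hab : a ≠ b) (hxy : x ≠ y) (hxz : x ≠ z) (hyz : y ≠ z)
    (hax : G.Adj a x) (hbx : G.Adj b x) (hay : G.Adj a y) (hby : G.Adj b y)
    (haz : G.Adj a z) (hbz : G.Adj b z) : False := by
  have key : ∀ x y, x ≠ y → G.Adj a x → G.Adj b x → G.Adj a y → G.Adj b y →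
      ∃ c : G.Walk a a, c.IsCycle ∧ c.edges = [s(a,x), s(x,b), s(b,y), s(y,a)] := by
    intro x y hxy hax hbx hay hby
    refine ⟨.cons hax (.cons hbx.symm (.cons hby (.cons hay.symm .nil))), ?_, by simp⟩
    have := hax.ne; have := hbx.ne; have := hay.ne; have := hby.ne
    rw [SimpleGraph.Walk.cons_isCycle_iff]
    simp [SimpleGraph.Walk.cons_isPath_iff]
    grind
  obtain ⟨c, hc, ec⟩ := key x y hxy hax hbx hay hby
  obtain ⟨d, hd, ed⟩ := key x z hxz hax hbx haz hbz
  have := (hG.2 a a c d hc hd s(a,x) (by simp [ec]) (by simp [ed]) s(b,y)).1 (by simp [ec])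
  rw [ed] at this
  have := hax.ne; have := hbx.ne; have := hay.ne; have := hby.ne
  simp at *
  grind

lemma aux_avoid {E ι : Type*} [AddCommGroup E] [Module ℝ E] [Finite ι] (W : Submodule ℝ E)
    (p : ι → Submodule ℝ E) (h : ∀ i, ¬ W ≤ p i) : ∃ x ∈ W, ∀ i, x ∉ p i := by
  by_contra! hcon
  have : ⋃ i, (((p i).comap W.subtype : Submodule ℝ W) : Set W) = Set.univ := by
    ext x
    obtain ⟨i, hi⟩ := hcon x x.2
    simp only [Set.mem_iUnion, Set.mem_univ, iff_true]
    exact ⟨i, hi⟩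
  obtain ⟨i, hi⟩ := Subspace.exists_eq_top_of_iUnion_eq_univ this
  apply h i
  intro x hx
  have : (⟨x, hx⟩ : W) ∈ (p i).comap W.subtype := by rw [hi]; trivial
  exact this

lemma aux_span_le {V E : Type*} [AddCommGroup E] [Module ℝ E] (v : V → E) (T : Finset V) :
    Module.finrank ℝ (Submodule.span ℝ (v '' (T : Set V))) ≤ T.card := by
  classical
  have := finrank_span_finset_le_card (R := ℝ) (T.image v)
  rw [Finset.coe_image] at this
  exact this.trans Finset.card_image_le

lemma aux_rep {n k : ℕ} (hk : k ≤ 2) (G : SimpleGraph (Fin n)) [DecidableRel G.Adj]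
    (hdeg : ∀ S : Finset (Fin n), S.Nonempty → ∃ w ∈ S, (S.filter (G.Adj w)).card ≤ k)
    (h23 : ∀ a b x y z : Fin n, a ≠ b → x ≠ y → x ≠ z → y ≠ z → G.Adj a x → G.Adj b x →
      G.Adj a y → G.Adj b y → G.Adj a z → G.Adj b z → False)
    (m : ℕ) (S : Finset (Fin n)) (hm : S.card = m) :
    ∃ v : Fin n → EuclideanSpace ℝ (Fin (k+2)),
      (∀ i ∈ S, ∀ j ∈ S, i ≠ j → (inner ℝ (v i) (v j) = 0 ↔ G.Adj i j)) ∧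
      ∀ T ⊆ S, T.card ≤ k + 1 → LinearIndepOn ℝ v (T : Set (Fin n)) := by
  classical
  induction m generalizing S with
  | zero =>
    rw [Finset.card_eq_zero] at hm
    subst hm
    refine ⟨0, by simp, ?_⟩
    intro T hT _
    rw [Finset.subset_empty] at hT
    subst hT
    simp
  | succ m ih =>
    obtain ⟨w, hwS, hdw⟩ := hdeg S (by rw [← Finset.card_pos]; omega)
    set N := S.filter (G.Adj w) with hN
    obtain ⟨v, hv1, hv2⟩ := ih (S.erase w) (by rw [Finset.card_erase_of_mem hwS]; omega)
    have hNS : N ⊆ S.erase w := by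
      intro x hx
      rw [hN, Finset.mem_filter] at hx
      exact Finset.mem_erase.2 ⟨hx.2.ne.symm, hx.1⟩
    set K := Submodule.span ℝ (v '' (N : Set (Fin n))) with hK
    have hKd : Module.finrank ℝ K ≤ N.card := aux_span_le v N
    have hWd : Module.finrank ℝ K + Module.finrank ℝ Kᗮ = k + 2 := by
      have := K.finrank_add_finrank_orthogonal
      simpa using this
    let ι := {y // y ∈ S.erase w \ N} ⊕ {T : Finset (Fin n) // T ⊆ S.erase w ∧ T.card ≤ k}
    let p : ι → Submodule ℝ (EuclideanSpace ℝ (Fin (k+2))) :=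
      Sum.elim (fun y => (Submodule.span ℝ {v y.1})ᗮ)
        (fun T => Submodule.span ℝ (v '' (T.1 : Set (Fin n))))
    have hp : ∀ i, ¬ Kᗮ ≤ p i := by
      rintro (⟨y, hy⟩ | ⟨T, hT, hTc⟩) hle
      · rw [Finset.mem_sdiff] at hy
        simp only [p, Sum.elim_inl] at hle
        rw [Submodule.orthogonal_le_orthogonal_iff, Submodule.span_singleton_le_iff_mem] at hle
        have hli := hv2 (insert y N) (Finset.insert_subset hy.1 hNS)
          ((Finset.card_insert_le _ _).trans (by omega))
        rw [Finset.coe_insert] at hli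
        exact hli.notMem_span_of_insert (by simpa using hy.2) hle
      · simp only [p, Sum.elim_inr] at hle
        have h1 := Submodule.finrank_mono hle
        have h2 := aux_span_le v T
        have hTc2 : T.card = 2 := by omega
        have hNc2 : N.card = 2 := by omega
        have heq := Submodule.eq_of_le_of_finrank_le hle (by omega)
        have horth : ∀ t ∈ T, ∀ a ∈ N, G.Adj a t := by
          intro t ht a ha
          have hmem : v t ∈ Kᗮ := by
            rw [heq]; exact Submodule.subset_span ⟨t, by simpa using ht, rfl⟩
          have h0 : inner ℝ (v a) (v t) = 0 :=
            (Submodule.mem_orthogonal _ _).1 hmem _ (Submodule.subset_span ⟨a, by simpa using ha, rfl⟩)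
          have hne : a ≠ t := by
            rintro rfl
            have hz : v a = 0 := inner_self_eq_zero.1 h0
            have hli := hv2 {a} (by simpa using hT ht) (by simp)
            exact hli.ne_zero (i := a) (by simp) hz
          exact (hv1 a (hNS ha) t (hT ht) hne).1 h0
        obtain ⟨a, b, hab, hNe⟩ := Finset.card_eq_two.1 hNc2
        obtain ⟨x, y, hxy, hTe⟩ := Finset.card_eq_two.1 hTc2
        have ha : a ∈ N := by simp [hNe]
        have hb : b ∈ N := by simp [hNe]
        have hx : x ∈ T := by simp [hTe]
        have hy : y ∈ T := by simp [hTe]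
        exact h23 a b x y w hab hxy (Finset.ne_of_mem_erase (hT hx))
          (Finset.ne_of_mem_erase (hT hy)) (horth x hx a ha) (horth x hx b hb)
          (horth y hy a ha) (horth y hy b hb)
          (Finset.mem_filter.1 ha).2.symm (Finset.mem_filter.1 hb).2.symm
    obtain ⟨u, huW, hu⟩ := aux_avoid Kᗮ p hp
    have hwu : ∀ j ∈ S.erase w, (inner ℝ u (v j) = 0 ↔ G.Adj w j) := by
      intro j hj
      constructor
      · intro h0
        by_contra hna
        have hjN : j ∉ N := fun h => hna (Finset.mem_filter.1 h).2
        apply hu (Sum.inl ⟨j, Finset.mem_sdiff.2 ⟨hj, hjN⟩⟩)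
        simp only [p, Sum.elim_inl]
        rw [Submodule.mem_orthogonal_singleton_iff_inner_left]
        exact h0
      · intro h
        have hjN : j ∈ N := Finset.mem_filter.2 ⟨Finset.mem_of_mem_erase hj, h⟩
        exact (Submodule.mem_orthogonal' _ _).1 huW _ (Submodule.subset_span ⟨j, by simpa using hjN, rfl⟩)
    refine ⟨Function.update v w u, ?_, ?_⟩
    · intro i hi j hj hij
      by_cases hiw : i = w
      · subst hiw
        rw [Function.update_self, Function.update_of_ne hij.symm]
        exact hwu j (Finset.mem_erase.2 ⟨hij.symm, hj⟩)
      · by_cases hjw : j = w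
        · subst hjw
          rw [Function.update_self, Function.update_of_ne hij, real_inner_comm, G.adj_comm]
          exact hwu i (Finset.mem_erase.2 ⟨hij, hi⟩)
        · rw [Function.update_of_ne hiw, Function.update_of_ne hjw]
          exact hv1 i (Finset.mem_erase.2 ⟨hiw, hi⟩) j (Finset.mem_erase.2 ⟨hjw, hj⟩) hij
    · intro T hT hTc
      have hcongr : ∀ T' : Finset (Fin n), w ∉ T' →
          Set.EqOn v (Function.update v w u) (T' : Set (Fin n)) := by
        intro T' hw x hx
        rw [Function.update_of_ne]
        rintro rfl
        exact hw (by simpa using hx)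
      by_cases hwT : w ∈ T
      · have hsub : T.erase w ⊆ S.erase w := Finset.erase_subset_erase _ hT
        have hc : (T.erase w).card ≤ k := by rw [Finset.card_erase_of_mem hwT]; omega
        rw [← Finset.insert_erase hwT, Finset.coe_insert, linearIndepOn_insert (by simp)]
        have he := hcongr (T.erase w) (by simp)
        refine ⟨(hv2 _ hsub (by omega)).congr he, ?_⟩
        rw [Function.update_self, ← Set.EqOn.image_eq he]
        exact hu (Sum.inr ⟨T.erase w, hsub, hc⟩)
      · refine (hv2 T ?_ hTc).congr (hcongr T hwT)
        intro x hx
        exact Finset.mem_erase.2 ⟨fun h => hwT (h ▸ hx), hT hx⟩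

lemma aux_compl {n k : ℕ} (hk : k ≤ 2) (G : SimpleGraph (Fin n)) [DecidableRel G.Adj]
    (hdeg : ∀ S : Finset (Fin n), S.Nonempty → ∃ w ∈ S, (S.filter (G.Adj w)).card ≤ k)
    (h23 : ∀ a b x y z : Fin n, a ≠ b → x ≠ y → x ≠ z → y ≠ z → G.Adj a x → G.Adj b x →
      G.Adj a y → G.Adj b y → G.Adj a z → G.Adj b z → False) : msr Gᶜ ≤ k + 2 := by
  obtain ⟨v, hv, -⟩ := aux_rep hk G hdeg h23 _ Finset.univ rfl
  let M : Matrix (Fin (k+2)) (Fin n) ℝ := Matrix.of fun i j => v j i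
  have hM : ∀ i j, (M.transpose * M) i j = inner ℝ (v i) (v j) := by
    intro i j
    simp [M, Matrix.mul_apply, PiLp.inner_apply, mul_comm]
  have hle : (M.transpose * M).rank ≤ k + 2 :=
    (Matrix.rank_mul_le_right _ _).trans (Matrix.rank_le_height _)
  refine le_trans (b := (M.transpose * M).rank) (Nat.sInf_le ⟨M.transpose * M, ?_, ?_, rfl⟩) hle
  · have := Matrix.posSemidef_conjTranspose_mul_self M
    rwa [Matrix.conjTranspose_eq_transpose_of_trivial] at this
  · intro i j hij
    rw [hM, SimpleGraph.compl_adj, ne_eq, hv i (by simp) j (by simp) hij]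
    simp [hij]

/-- Every cactus graph satisfies the positive semidefinite graph complement
conjecture: `msr(G) + msr(Ḡ) ≤ |G| + 2`. -/
theorem cactus_gcc_plus {n : ℕ}
    (G : SimpleGraph (Fin n)) (hG : IsCactus G) :
    msr G + msr Gᶜ ≤ n + 2 := by
  classical
  have hn : 0 < n := by
    obtain ⟨x⟩ := hG.1.nonempty
    exact x.pos
  by_cases hc : G.IsAcyclic
  · have h1 := aux_msr_conn G hn
    have h2 := aux_compl (k := 1) (by norm_num) G (aux_deg1 G hc) (aux_k23 G hG)
    omega
  · have h1 := aux_msr_cycle G hG.1 hc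
    have h2 := aux_compl (k := 2) (by norm_num) G (aux_deg2 G hG) (aux_k23 G hG)
    omega
end

section
/- Let G = (V, E) be a cactus graph containing at least two cycles (equivalently, G is connected with |E| ≥ |V| + 1). Then msr(G) ≤ |G| − 3. -/
/-- Signed incidence vector of an (arbitrarily oriented) edge. -/
noncomputable def dvec {n : ℕ} (e : Sym2 (Fin n)) (i : Fin n) : ℝ :=
  (if i = e.out.2 then 1 else 0) - (if i = e.out.1 then 1 else 0)

lemma out_eq {n : ℕ} (e : Sym2 (Fin n)) : s(e.out.1, e.out.2) = e := by
  have := Quot.out_eq e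
  exact this

lemma dvec_mul {n : ℕ} (e : Sym2 (Fin n)) {i j : Fin n} (hij : i ≠ j) :
    dvec e i * dvec e j = if e = s(i, j) then -1 else 0 := by
  have h := out_eq e
  unfold dvec
  generalize e.out.1 = a at *
  generalize e.out.2 = b at *
  subst h
  by_cases h1 : i = a <;> by_cases h2 : i = b <;> by_cases h3 : j = a <;> by_cases h4 : j = b <;>
    simp_all <;> grind

lemma dvec_pair {n : ℕ} (u v : Fin n) : ∃ c : ℝ, ∀ i, c * dvec s(u, v) i =
    (if i = v then 1 else 0) - (if i = u then 1 else 0) := by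
  have h := out_eq s(u, v)
  unfold dvec
  generalize (Quot.out s(u, v)).1 = a at *
  generalize (Quot.out s(u, v)).2 = b at *
  rcases Sym2.eq_iff.1 h with ⟨rfl, rfl⟩ | ⟨rfl, rfl⟩
  · exact ⟨1, fun i => by ring⟩
  · exact ⟨-1, fun i => by ring⟩

open Classical in
lemma walk_flow {n : ℕ} {T : SimpleGraph (Fin n)} {u v : Fin n} (p : T.Walk u v) :
    ∃ s : T.edgeSet → ℝ, (∀ e, s e ≠ 0 → (e : Sym2 (Fin n)) ∈ p.edges) ∧
      ∀ i, ∑ e, s e * dvec (e : Sym2 (Fin n)) i =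
        (if i = v then 1 else 0) - (if i = u then 1 else 0) := by
  induction p with
  | nil => exact ⟨0, by simp, by simp⟩
  | @cons u w v h p ih =>
    obtain ⟨s, hs, hd⟩ := ih
    obtain ⟨c, hc⟩ := dvec_pair u w
    refine ⟨fun e => (if e = ⟨s(u, w), h⟩ then c else 0) + s e, ?_, ?_⟩
    · intro e he
      by_cases h1 : e = ⟨s(u, w), h⟩
      · subst h1; simp
      · simp only [h1, if_false, zero_add] at he
        simp [hs e he]
    · intro i
      simp only [add_mul, Finset.sum_add_distrib, hd, ite_mul, zero_mul, Finset.sum_ite_eq',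
        Finset.mem_univ, if_true, hc]
      ring

open Classical in
lemma sum_dvec {n : ℕ} (H : SimpleGraph (Fin n)) (w : H.edgeSet → ℝ) {i j : Fin n} (hij : i ≠ j) :
    ∑ e : H.edgeSet, w e * (dvec (e : Sym2 (Fin n)) i * dvec (e : Sym2 (Fin n)) j) =
      if h : H.Adj i j then - w ⟨s(i, j), h⟩ else 0 := by
  simp only [dvec_mul _ hij]
  split_ifs with h
  · rw [Finset.sum_eq_single ⟨s(i, j), h⟩]
    · simp
    · intro b _ hb
      rw [if_neg (fun h' => hb (Subtype.ext h')), mul_zero]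
    · simp
  · apply Finset.sum_eq_zero
    rintro ⟨e, he⟩ -
    rw [if_neg, mul_zero]
    rintro rfl
    exact h he

open Classical in
lemma fund_disjoint {n : ℕ} {G T : SimpleGraph (Fin n)} (hG : IsCactus G) (hT : T ≤ G)
    {a b c d : Fin n} (hab : (G \ T).Adj a b) (hcd : (G \ T).Adj c d) (hne : s(a, b) ≠ s(c, d))
    (p : T.Walk a b) (q : T.Walk c d) (hp : p.IsPath) (hq : q.IsPath)
    (e : Sym2 (Fin n)) (h1 : e ∈ p.edges) (h2 : e ∈ q.edges) : False := by
  have key : ∀ {a b : Fin n} (hab : (G \ T).Adj a b) (p : T.Walk a b), p.IsPath →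
      ∃ r : G.Walk b b, r.IsCycle ∧ ∀ e, e ∈ r.edges ↔ e = s(a, b) ∨ e ∈ p.edges := by
    intro a b hab p hp
    have hE : (p.mapLe hT).edges = p.edges := by simp
    refine ⟨SimpleGraph.Walk.cons hab.1.symm (p.mapLe hT), ?_, ?_⟩
    · refine SimpleGraph.Path.cons_isCycle ⟨p.mapLe hT, hp.mapLe hT⟩ hab.1.symm ?_
      rw [hE]
      intro h
      exact hab.2 (p.adj_of_mem_edges h).symm
    · intro e
      simp [hE, Sym2.eq_swap]
  obtain ⟨r1, c1, e1⟩ := key hab p hp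
  obtain ⟨r2, c2, e2⟩ := key hcd q hq
  have := (hG.2 _ _ r1 r2 c1 c2 e ((e1 e).2 (.inr h1)) ((e2 e).2 (.inr h2)) s(a, b)).1
    ((e1 _).2 (.inl rfl))
  rcases (e2 _).1 this with h | h
  · exact hne h
  · exact hab.2 (q.adj_of_mem_edges h)

open Classical Matrix in
theorem msr_aux {n : ℕ}
    (G : SimpleGraph (Fin n)) [DecidableRel G.Adj] (hG : IsCactus G)
    (hE : n + 1 ≤ G.edgeFinset.card) :
    msr G ≤ n - 3 := by
  obtain ⟨T, hTG, hT⟩ := hG.1.exists_isTree_le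
  have hTc := hT.card_edgeFinset
  rw [Fintype.card_fin] at hTc
  have hN : (G \ T).edgeFinset.card + T.edgeFinset.card = G.edgeFinset.card := by
    rw [SimpleGraph.edgeFinset_sdiff]
    exact Finset.card_sdiff_add_card_eq_card (SimpleGraph.edgeFinset_mono hTG)
  have hadj : ∀ e : (G \ T).edgeSet, (G \ T).Adj (e : Sym2 (Fin n)).out.1 (e : Sym2 (Fin n)).out.2 := by
    intro e
    rw [← SimpleGraph.mem_edgeSet, out_eq]
    exact e.2
  have hpath : ∀ e : (G \ T).edgeSet, ∃ p : T.Walk (e : Sym2 (Fin n)).out.1 (e : Sym2 (Fin n)).out.2,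
      p.IsPath := fun e => (hT.1.preconnected _ _).exists_isPath
  choose P hP using hpath
  choose s hs hd using fun e => walk_flow (P e)
  have horth : ∀ e f, e ≠ f → ∀ x, s e x * s f x = 0 := by
    intro e f hef x
    by_contra h
    have h1 := hs e x (left_ne_zero_of_mul h)
    have h2 := hs f x (right_ne_zero_of_mul h)
    refine fund_disjoint hG hTG (hadj e) (hadj f) ?_ (P e) (P f) (hP e) (hP f) _ h1 h2
    rw [out_eq, out_eq]
    exact fun h => hef (Subtype.ext h)
  have hpos : ∀ e, 0 < ∑ x, s e x * s e x := by
    intro e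
    refine lt_of_le_of_ne (Finset.sum_nonneg fun x _ => mul_self_nonneg _) fun h0 => ?_
    have hz := (Finset.sum_eq_zero_iff_of_nonneg fun x _ => mul_self_nonneg (s e x)).1 h0.symm
    have h1 := hd e (e : Sym2 (Fin n)).out.2
    rw [Finset.sum_eq_zero fun x hx => by rw [mul_self_eq_zero.1 (hz x hx), zero_mul]] at h1
    simp [(hadj e).ne'] at h1
  let c : (G \ T).edgeSet → ℝ := fun e => (Real.sqrt (∑ x, s e x * s e x))⁻¹
  have hc : ∀ e, 0 < c e := fun e => inv_pos.2 (Real.sqrt_pos.2 (hpos e))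
  have hcc : ∀ e, c e * c e * ∑ x, s e x * s e x = 1 := by
    intro e
    simp only [c]
    rw [← mul_inv, Real.mul_self_sqrt (hpos e).le, inv_mul_cancel₀ (hpos e).ne']
  let S : Matrix (G \ T).edgeSet T.edgeSet ℝ := Matrix.of fun e x => c e * s e x
  let B : Matrix T.edgeSet (Fin n) ℝ := Matrix.of fun x i => dvec (x : Sym2 (Fin n)) i
  have hSS : S * Sᵀ = 1 := by
    ext e f
    rw [Matrix.mul_apply]
    by_cases hef : e = f
    · subst hef
      rw [Matrix.one_apply_eq, ← hcc e, Finset.mul_sum]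
      exact Finset.sum_congr rfl fun x _ => by simp [S]; ring
    · rw [Matrix.one_apply_ne hef]
      refine Finset.sum_eq_zero fun x _ => ?_
      simp only [S, Matrix.of_apply, Matrix.transpose_apply]
      linear_combination c e * c f * horth e f hef x
  have hSB : ∀ e i, (S * B) e i = c e * dvec (e : Sym2 (Fin n)) i := by
    intro e i
    rw [Matrix.mul_apply, dvec, ← hd e i, Finset.mul_sum]
    exact Finset.sum_congr rfl fun x _ => by simp [S, B]; ring
  let M : Matrix T.edgeSet T.edgeSet ℝ := 1 - Sᵀ * S
  have hMt : Mᵀ = M := by simp [M]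
  have hSM : S * M = 0 := by
    simp only [M]
    rw [Matrix.mul_sub, ← Matrix.mul_assoc, hSS]; simp
  have hMM : M * M = M := by
    conv_lhs => enter [1]; simp only [M]
    rw [Matrix.sub_mul, Matrix.mul_assoc, hSM]; simp
  have hrS : (G \ T).edgeFinset.card ≤ S.rank := by
    have h := Matrix.rank_mul_le_left S Sᵀ
    rw [hSS, Matrix.rank_one] at h
    rwa [SimpleGraph.card_edgeSet] at h
  have hrM : S.rank + M.rank ≤ T.edgeFinset.card := by
    have h := Matrix.rank_add_rank_le_card_of_mul_eq_zero hSM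
    rwa [SimpleGraph.card_edgeSet] at h
  let A : Matrix (Fin n) (Fin n) ℝ := (M * B)ᵀ * (M * B)
  have hA : A = Bᵀ * B - (S * B)ᵀ * (S * B) := by
    simp only [A]
    rw [Matrix.transpose_mul, hMt, Matrix.mul_assoc, ← Matrix.mul_assoc M, hMM]
    simp only [M, Matrix.sub_mul, Matrix.mul_sub, Matrix.transpose_mul, Matrix.mul_assoc, Matrix.one_mul]
  have hrA : A.rank ≤ n - 3 := by
    have h1 : A.rank ≤ M.rank :=
      (Matrix.rank_mul_le_right _ _).trans (Matrix.rank_mul_le_left _ _)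
    omega
  refine (Nat.sInf_le ⟨A, ?_, ?_, rfl⟩ : msr G ≤ A.rank).trans hrA
  · have := Matrix.posSemidef_conjTranspose_mul_self (M * B)
    rwa [Matrix.conjTranspose_eq_transpose_of_trivial] at this
  · intro i j hij
    have hAij : A i j = (if h : T.Adj i j then - 1 else 0) -
        (if h : (G \ T).Adj i j then - (c ⟨s(i, j), h⟩ * c ⟨s(i, j), h⟩) else 0) := by
      have e1 := sum_dvec T (fun _ => 1) hij
      have e2 := sum_dvec (G \ T) (fun e => c e * c e) hij
      have f1 : (Bᵀ * B) i j = ∑ e : T.edgeSet,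
          (1 : ℝ) * (dvec (e : Sym2 (Fin n)) i * dvec (e : Sym2 (Fin n)) j) := by
        rw [Matrix.mul_apply]
        exact Finset.sum_congr rfl fun x _ => by simp [B]
      have f2 : ((S * B)ᵀ * (S * B)) i j = ∑ e : (G \ T).edgeSet,
          c e * c e * (dvec (e : Sym2 (Fin n)) i * dvec (e : Sym2 (Fin n)) j) := by
        rw [Matrix.mul_apply]
        refine Finset.sum_congr rfl fun x _ => ?_
        rw [Matrix.transpose_apply, hSB, hSB]; ring
      rw [hA, Matrix.sub_apply, f1, f2]
      convert congrArg₂ (fun x y : ℝ => x - y) e1 e2 using 3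
      ext x; simp
    rw [hAij]
    by_cases h1 : T.Adj i j
    · have h2 : ¬ (G \ T).Adj i j := fun h => h.2 h1
      simp [h1, hTG h1]
    · by_cases h2 : G.Adj i j
      · have h3 : (G \ T).Adj i j := ⟨h2, h1⟩
        rw [dif_neg h1, dif_pos h3]
        have := hc ⟨s(i, j), h3⟩
        simp [h2, this.ne']
      · simp [h1, h2]

/-- A cactus graph with at least two cycles (equivalently, connected with
`|E| ≥ |V| + 1`) satisfies `msr(G) ≤ |G| - 3`. -/
theorem msr_le_of_cactus_two_cycles {n : ℕ}
    (G : SimpleGraph (Fin n)) [DecidableRel G.Adj] (hG : IsCactus G)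
    (hE : n + 1 ≤ G.edgeFinset.card) :
    msr G ≤ n - 3 := by
  exact msr_aux G hG hE
end
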